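/- arXiv:1902.05666 — 2 statements merged into one kernel-verified Lean document; each statement's English description precedes it below -/
import Mathlib

section
/- Assume the abc-conjecture and let n ≥ 2 be an integer. Then there exists a finite set S₀ of primes such that for every prime p ∉ S₀ and every integer k with p ∤ k, there exists an irreducible polynomial f ∈ ℚ[X] of degree n whose Galois group (the Galois group of its splitting field over ℚ) is isomorphic to the symmetric group Sₙ, such that the discriminant of the degree-n number field F = ℚ[X]/(f) is congruent to k modulo p. -/
/-- The radical of a natural number: the product of its distinct prime factors. -/
def Rad (m : ℕ) : ℕ := ∏ q ∈ m.primeFactors, q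

/-- The abc-conjecture: for every `ε > 0` there is a constant `C > 0` such that
`c ≤ C · rad(abc)^(1+ε)` for all coprime positive integers `a + b = c`. -/
def AbcConjecture : Prop :=
  ∀ ε : ℝ, 0 < ε → ∃ C : ℝ, 0 < C ∧ ∀ a b c : ℕ, 0 < a → 0 < b → 0 < c →
    Nat.Coprime a b → a + b = c → (c : ℝ) ≤ C * (Rad (a * b * c) : ℝ) ^ (1 + ε)

open Finset in
theorem exists_sum_mul_eq_zero_of_card {p : ℕ} [Fact p.Prime] {H : Finset (ZMod p)}
    (hH0 : H.Nonempty) (hH : ∀ h₀ ∈ H, h₀ ≠ 0 ∧ H.image (fun h => h₀ * h) = H)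
    (hcard : p ^ 3 < #H ^ 4) {a b c : ZMod p} (ha : a ≠ 0) (hb : b ≠ 0) (hc : c ≠ 0) :
    ∃ x ∈ H, ∃ y ∈ H, ∃ z ∈ H, a * x + b * y + c * z = 0 := by
  classical
  have hp : p.Prime := Fact.out
  let ψ : AddChar (ZMod p) ℂ := ZMod.stdAddChar
  have hψ : ψ.IsPrimitive := ZMod.isPrimitive_stdAddChar p
  have horth (b : ZMod p) : ∑ t, ψ (t * b) = if b = 0 then (p : ℂ) else 0 := by
    have := AddChar.sum_mulShift b hψ
    simpa [ZMod.card] using this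
  have hconj (x : ZMod p) : (starRingEnd ℂ) (ψ x) = ψ (-x) := by
    rw [AddChar.map_neg_eq_conj]
  let η : ZMod p → ℂ := fun t => ∑ h ∈ H, ψ (t * h)
  have hpars : ∑ t, ‖η t‖ ^ 2 = (p : ℝ) * #H := by
    have h1 : ∑ t, η t * (starRingEnd ℂ) (η t) = (p : ℂ) * #H := by
      calc ∑ t, η t * (starRingEnd ℂ) (η t)
          = ∑ t, ∑ h ∈ H, ∑ h' ∈ H, ψ (t * (h - h')) := by
            refine sum_congr rfl fun t _ => ?_
            simp only [η, map_sum, sum_mul_sum, hconj]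
            refine sum_congr rfl fun h _ => sum_congr rfl fun h' _ => ?_
            rw [← AddChar.map_add_eq_mul]; ring_nf
        _ = ∑ h ∈ H, ∑ h' ∈ H, ∑ t, ψ (t * (h - h')) := by
            rw [sum_comm]; refine sum_congr rfl fun h _ => ?_; rw [sum_comm]
        _ = ∑ h ∈ H, (p : ℂ) := by
            refine sum_congr rfl fun h hh => ?_
            simp only [horth, sub_eq_zero]
            simp [hh]
        _ = _ := by simp [mul_comm]
    have h2 : ∀ t, η t * (starRingEnd ℂ) (η t) = ((‖η t‖ ^ 2 : ℝ) : ℂ) := fun t => by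
      rw [Complex.mul_conj, Complex.normSq_eq_norm_sq]
    simp only [h2] at h1
    exact_mod_cast h1
  have hinv (t h₀ : ZMod p) (h : h₀ ∈ H) : η (t * h₀) = η t := by
    obtain ⟨h1, h2⟩ := hH h₀ h
    simp only [η]
    conv_rhs => rw [← h2]
    rw [sum_image (fun x _ y _ hxy => mul_left_cancel₀ h1 hxy)]
    simp [mul_assoc]
  have hcpos : (0 : ℝ) < #H := by exact_mod_cast hH0.card_pos
  have hbd (t : ZMod p) (ht : t ≠ 0) : ‖η t‖ ≤ √p := by
    apply Real.le_sqrt_of_sq_le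
    have : ∑ h₀ ∈ H, ‖η (t * h₀)‖ ^ 2 ≤ ∑ t, ‖η t‖ ^ 2 := by
      rw [← sum_image (f := fun u => ‖η u‖ ^ 2) (g := fun h₀ => t * h₀)
        (fun x _ y _ hxy => mul_left_cancel₀ ht hxy)]
      exact sum_le_sum_of_subset_of_nonneg (subset_univ _) (fun _ _ _ => by positivity)
    rw [sum_congr rfl (fun h₀ hh => by rw [hinv t h₀ hh]), hpars] at this
    simp only [sum_const, nsmul_eq_mul] at this
    nlinarith
  have hscale (a : ZMod p) (ha : a ≠ 0) : ∑ t, ‖η (a * t)‖ ^ 2 = (p : ℝ) * #H := by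
    rw [← hpars]
    exact Fintype.sum_bijective (fun t => a * t) (mulLeft_bijective₀ a ha) _ _ (fun _ => rfl)
  by_contra! hcon
  have hz : ∑ t, η (a * t) * η (b * t) * η (c * t) = 0 := by
    calc ∑ t, η (a * t) * η (b * t) * η (c * t)
        = ∑ t, ∑ x ∈ H, ∑ y ∈ H, ∑ z ∈ H, ψ (t * (a * x + b * y + c * z)) := by
          refine sum_congr rfl fun t _ => ?_
          simp only [η]
          rw [sum_mul_sum, sum_mul]
          refine sum_congr rfl fun x _ => ?_
          rw [sum_mul]
          refine sum_congr rfl fun y _ => ?_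
          rw [mul_sum]
          refine sum_congr rfl fun z _ => ?_
          rw [← AddChar.map_add_eq_mul, ← AddChar.map_add_eq_mul]; ring_nf
      _ = ∑ x ∈ H, ∑ y ∈ H, ∑ z ∈ H, ∑ t, ψ (t * (a * x + b * y + c * z)) := by
          rw [sum_comm]; refine sum_congr rfl fun h _ => ?_
          rw [sum_comm]; refine sum_congr rfl fun h _ => ?_; rw [sum_comm]
      _ = 0 := by
          refine sum_eq_zero fun x hx => sum_eq_zero fun y hy => sum_eq_zero fun z hz => ?_
          rw [horth, if_neg (hcon x hx y hy z hz)]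
  have hη0 : η 0 = #H := by simp [η]
  rw [← add_sum_erase _ _ (mem_univ 0)] at hz
  simp only [mul_zero, hη0] at hz
  have h3 : ((#H : ℝ)) ^ 3 ≤ √p * (p * #H) := by
    have e1 : ((#H : ℂ)) ^ 3 = -∑ t ∈ univ.erase 0, η (a * t) * η (b * t) * η (c * t) := by
      linear_combination hz
    have e2 : ((#H : ℝ)) ^ 3 = ‖∑ t ∈ univ.erase 0, η (a * t) * η (b * t) * η (c * t)‖ := by
      rw [← norm_neg, ← e1]; simp
    rw [e2]
    calc _ ≤ ∑ t ∈ univ.erase 0, ‖η (a * t) * η (b * t) * η (c * t)‖ := norm_sum_le _ _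
      _ ≤ ∑ t ∈ univ.erase (0 : ZMod p), √p * ((‖η (a * t)‖ ^ 2 + ‖η (b * t)‖ ^ 2) / 2) := by
          refine sum_le_sum fun t ht => ?_
          rw [norm_mul, norm_mul, mul_comm]
          have := hbd (c * t) (mul_ne_zero hc (ne_of_mem_erase ht))
          gcongr
          nlinarith [sq_nonneg (‖η (a * t)‖ - ‖η (b * t)‖)]
      _ ≤ ∑ t, √p * ((‖η (a * t)‖ ^ 2 + ‖η (b * t)‖ ^ 2) / 2) :=
          sum_le_sum_of_subset_of_nonneg (subset_univ _) (fun _ _ _ => by positivity)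
      _ = _ := by
          rw [← mul_sum, ← sum_div, sum_add_distrib, hscale a ha, hscale b hb]; ring
  have h4 : (#H : ℝ) ^ 2 ≤ √p * p := by
    have : (#H : ℝ) ^ 2 * #H ≤ √p * p * #H := by nlinarith
    exact le_of_mul_le_mul_right this hcpos
  have h5 : (#H : ℝ) ^ 4 ≤ p ^ 3 := by
    calc (#H : ℝ) ^ 4 = ((#H : ℝ) ^ 2) ^ 2 := by ring
      _ ≤ (√p * p) ^ 2 := by gcongr
      _ = p ^ 3 := by rw [mul_pow, Real.sq_sqrt (by positivity)]; ring
  have h6 : #H ^ 4 ≤ p ^ 3 := by exact_mod_cast h5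
  omega

open Finset in
theorem exists_mul_pow_add_mul_pow_eq {p N : ℕ} [Fact p.Prime] (hN : 0 < N) (hp : 16 * N ^ 4 < p)
    {a b c : ZMod p} (ha : a ≠ 0) (hb : b ≠ 0) (hc : c ≠ 0) :
    ∃ x y : ZMod p, x ≠ 0 ∧ y ≠ 0 ∧ a * x ^ N + b * y ^ N = c := by
  classical
  let H : Finset (ZMod p) := (univ.erase (0 : ZMod p)).image (fun x => x ^ N)
  have hmem (h : ZMod p) : h ∈ H ↔ ∃ x, x ≠ 0 ∧ x ^ N = h := by simp [H]
  have hpp : p.Prime := Fact.out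
  have hcard : p - 1 ≤ N * #H := by
    have := card_le_mul_card_image (f := fun x : ZMod p => x ^ N) (univ.erase (0 : ZMod p)) N ?_
    · rwa [card_erase_of_mem (mem_univ _), card_univ, ZMod.card] at this
    · intro h _
      have : (univ.erase (0 : ZMod p)).filter (fun x => x ^ N = h) ⊆
          (Polynomial.nthRoots N h).toFinset := by
        intro x hx
        simp only [mem_filter] at hx
        simp [Polynomial.mem_nthRoots hN, hx.2]
      refine (card_le_card this).trans
        ((Multiset.toFinset_card_le _).trans (Polynomial.card_nthRoots _ _))
  have hlt : p ^ 3 < #H ^ 4 := by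
    by_contra! hle
    have h1 : (p - 1) ^ 4 ≤ N ^ 4 * p ^ 3 := by
      calc (p - 1) ^ 4 ≤ (N * #H) ^ 4 := by gcongr
        _ = N ^ 4 * #H ^ 4 := by ring
        _ ≤ _ := by gcongr
    have h2 : p ≤ 2 * (p - 1) := by have := hpp.two_le; omega
    have h3 : p ^ 4 ≤ 16 * (p - 1) ^ 4 := by
      calc p ^ 4 ≤ (2 * (p - 1)) ^ 4 := by gcongr
        _ = _ := by ring
    have h4 : p * p ^ 3 ≤ 16 * N ^ 4 * p ^ 3 := by nlinarith
    have := Nat.le_of_mul_le_mul_right h4 (pow_pos hpp.pos 3)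
    omega
  obtain ⟨x, hx, y, hy, z, hz, h⟩ := exists_sum_mul_eq_zero_of_card (H := H)
    ⟨1, (hmem 1).2 ⟨1, one_ne_zero, one_pow N⟩⟩ (by
      intro h₀ hh
      obtain ⟨x, hx, rfl⟩ := (hmem _).1 hh
      refine ⟨pow_ne_zero _ hx, ?_⟩
      ext w
      simp only [mem_image, hmem]
      constructor
      · rintro ⟨_, ⟨y, hy, rfl⟩, rfl⟩
        exact ⟨x * y, mul_ne_zero hx hy, mul_pow _ _ _⟩
      · rintro ⟨y, hy, rfl⟩
        exact ⟨_, ⟨y / x, div_ne_zero hy hx, rfl⟩, by rw [← mul_pow, mul_div_cancel₀ _ hx]⟩)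
    hlt ha hb (neg_ne_zero.2 hc)
  obtain ⟨x, hx0, rfl⟩ := (hmem _).1 hx
  obtain ⟨y, hy0, rfl⟩ := (hmem _).1 hy
  obtain ⟨z, hz0, rfl⟩ := (hmem _).1 hz
  refine ⟨x / z, y / z, div_ne_zero hx0 hz0, div_ne_zero hy0 hz0, ?_⟩
  have hz := pow_ne_zero N hz0
  rw [div_pow, div_pow]
  field_simp
  linear_combination h

open Finset in
theorem card_filter_sq_dvd_le {u v : ℤ} {r T : ℕ} (hr : 0 < r) (h : IsCoprime (r : ℤ) u) :
    #((range T).filter fun t : ℕ => ((r : ℤ) ^ 2 ∣ u * (t : ℤ) + v)) ≤ T / r ^ 2 + 1 := by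
  classical
  have h2 : IsCoprime ((r : ℤ) ^ 2) u := h.pow_left
  by_cases hne : (((range T).filter fun t : ℕ => ((r : ℤ) ^ 2 ∣ u * (t : ℤ) + v))).Nonempty
  swap
  · rw [not_nonempty_iff_eq_empty.1 hne]; simp
  obtain ⟨t₀, ht₀⟩ := hne
  have hsub : ((range T).filter fun t : ℕ => ((r : ℤ) ^ 2 ∣ u * (t : ℤ) + v)) ⊆
      ((range T).filter fun t : ℕ => t ≡ t₀ [MOD r ^ 2]) := by
    intro t ht
    simp only [mem_filter] at ht ht₀ ⊢
    refine ⟨ht.1, ?_⟩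
    rw [Nat.ModEq.comm, ← Int.natCast_modEq_iff, Int.modEq_iff_dvd]
    push_cast
    have := dvd_sub ht.2 ht₀.2
    rw [show u * (t : ℤ) + v - (u * (t₀ : ℤ) + v) = u * ((t : ℤ) - t₀) by ring] at this
    exact h2.dvd_of_dvd_mul_left this
  refine (card_le_card hsub).trans ?_
  rw [← Nat.count_eq_card_filter_range, Nat.count_modEq_card _ (by positivity)]
  split_ifs <;> omega

open Finset in
theorem exists_squarefree_pair {u₁ v₁ u₂ v₂ : ℤ} (hu₁ : u₁ ≠ 0) (hu₂ : u₂ ≠ 0)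
    (h₁ : IsCoprime u₁ v₁) (h₂ : IsCoprime u₂ v₂) (he₁ : 2 ∣ u₁) (he₂ : 2 ∣ u₂) (t₀ : ℕ) :
    ∃ t : ℕ, t₀ ≤ t ∧ Squarefree (u₁ * (t : ℤ) + v₁) ∧ Squarefree (u₂ * (t : ℤ) + v₂) := by
  classical
  let C : ℕ := u₁.natAbs + v₁.natAbs + (u₂.natAbs + v₂.natAbs)
  have hC : 0 < C := by have := Int.natAbs_pos.2 hu₁; omega
  let N : ℕ := 10 * C + 10 * (t₀ + 2) 
  let T : ℕ := C * N ^ 2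
  let R : ℕ := C * N
  by_contra! hcon
  have key (u v : ℤ) (hu : u ≠ 0) (h : IsCoprime u v) (he : 2 ∣ u) (hc : u.natAbs + v.natAbs ≤ C)
      (t : ℕ) (ht : t < T) (hn : u * (t : ℤ) + v ≠ 0) (hs : ¬ Squarefree (u * (t : ℤ) + v)) :
      ∃ r ∈ Icc 3 R, IsCoprime (r : ℤ) u ∧ ((r : ℤ) ^ 2 ∣ u * (t : ℤ) + v) := by
    rw [← Int.squarefree_natAbs, Nat.squarefree_iff_prime_squarefree] at hs
    push Not at hs
    obtain ⟨r, hr, hd⟩ := hs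
    have hd' : (r : ℤ) ^ 2 ∣ u * (t : ℤ) + v := by
      rw [← Int.dvd_natAbs, pow_two]; exact_mod_cast hd
    have hrp : Prime (r : ℤ) := Nat.prime_iff_prime_int.1 hr
    have hcop : IsCoprime (r : ℤ) u := by
      rw [Prime.coprime_iff_not_dvd hrp]
      intro hru
      have : (r : ℤ) ∣ v := by
        have h3 : (r : ℤ) ∣ u * (t : ℤ) + v := (dvd_pow_self _ two_ne_zero).trans hd'
        exact (dvd_add_right (hru.mul_right _)).1 h3
      exact hrp.not_isUnit (h.isUnit_of_dvd' hru this)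
    refine ⟨r, mem_Icc.2 ⟨?_, ?_⟩, hcop, hd'⟩
    · by_contra! hlt
      have : r = 2 := by have := hr.two_le; omega
      subst this
      exact hrp.not_isUnit (hcop.isUnit_of_dvd' dvd_rfl he)
    · have hle : r * r ≤ (u * (t : ℤ) + v).natAbs := Nat.le_of_dvd (Int.natAbs_pos.2 hn) hd
      have h4 : (u * (t : ℤ) + v).natAbs ≤ u.natAbs * t + v.natAbs := by
        refine (Int.natAbs_add_le _ _).trans ?_
        rw [Int.natAbs_mul, Int.natAbs_natCast]
      have h5 : u.natAbs * t + v.natAbs ≤ C * T := by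
        calc u.natAbs * t + v.natAbs ≤ u.natAbs * T + v.natAbs * T := by
              gcongr; exact Nat.le_mul_of_pos_right _ (by omega)
          _ = (u.natAbs + v.natAbs) * T := by ring
          _ ≤ C * T := by gcongr
      have h6 : r * r ≤ R * R := by
        calc r * r ≤ C * T := hle.trans (h4.trans h5)
          _ = R * R := by simp only [T, R]; ring
      exact Nat.mul_self_le_mul_self_iff.1 h6
  have hsum (u v : ℤ) : #((Icc 3 R).biUnion fun r => if IsCoprime (r : ℤ) u then
      ((range T).filter fun t : ℕ => ((r : ℤ) ^ 2 ∣ u * (t : ℤ) + v)) else ∅) ≤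
        (2 / 5 : ℝ) * T + R := by
    have h1 : (#((Icc 3 R).biUnion fun r => if IsCoprime (r : ℤ) u then
      ((range T).filter fun t : ℕ => ((r : ℤ) ^ 2 ∣ u * (t : ℤ) + v)) else ∅) : ℝ) ≤
        ∑ r ∈ Icc 3 R, ((T : ℝ) / r ^ 2 + 1) := by
      refine (Nat.cast_le.2 card_biUnion_le).trans ?_
      push_cast
      refine sum_le_sum fun r hr => ?_
      split_ifs with hc
      · have := card_filter_sq_dvd_le (v := v) (T := T) (r := r) (by have := mem_Icc.1 hr; omega) hc
        refine (Nat.cast_le.2 this).trans ?_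
        push_cast
        gcongr
        exact_mod_cast Nat.cast_div_le (α := ℝ) (m := T) (n := r ^ 2)
      · simp; positivity
    have h2 (R : ℕ) (hR : 2 ≤ R) : ∑ r ∈ Icc 3 R, ((T : ℝ) / r ^ 2 + 1) ≤
        (T : ℝ) * (2 / 5 - 1 / ((R : ℝ) + 1 / 2)) + (R : ℝ) := by
      induction R, hR using Nat.le_induction with
      | base => norm_num
      | succ R hR ih =>
        rw [← Finset.insert_Icc_right_eq_Icc_add_one (by omega), sum_insert (by simp)]
        have : (T : ℝ) / ((R + 1 : ℕ) : ℝ) ^ 2 ≤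
            T * (1 / (R + 1 / 2) - 1 / ((R + 1 : ℕ) + 1 / 2)) := by
          rw [div_eq_mul_one_div]
          gcongr
          push_cast
          rw [div_sub_div _ _ (by positivity) (by positivity),
            div_le_div_iff₀ (by positivity) (by positivity)]
          nlinarith
        push_cast at *
        linarith
    refine h1.trans ((h2 R (by simp only [R, N]; nlinarith)).trans ?_)
    have : (0 : ℝ) ≤ T * (1 / (R + 1 / 2)) := by positivity
    linarith
  have hzero (u v : ℤ) (hu : u ≠ 0) : #((range T).filter fun t : ℕ => u * (t : ℤ) + v = 0) ≤ 1 := by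
    rw [card_le_one]
    intro x hx y hy
    simp only [mem_filter] at hx hy
    have : u * ((x : ℤ) - y) = 0 := by linear_combination hx.2 - hy.2
    have := (mul_eq_zero.1 this).resolve_left hu
    omega
  let B (u v : ℤ) : Finset ℕ := ((Icc 3 R).biUnion fun r => if IsCoprime (r : ℤ) u then
      ((range T).filter fun t : ℕ => ((r : ℤ) ^ 2 ∣ u * (t : ℤ) + v)) else ∅) ∪
        ((range T).filter fun t : ℕ => u * (t : ℤ) + v = 0)
  have hB (u v : ℤ) (hu : u ≠ 0) : (#(B u v) : ℝ) ≤ (2 / 5 : ℝ) * T + R + 1 := by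
    refine (Nat.cast_le.2 (card_union_le _ _)).trans ?_
    push_cast
    have h1 := hsum u v
    have h2 : (#((range T).filter fun t : ℕ => u * (t : ℤ) + v = 0) : ℝ) ≤ 1 := by
      exact_mod_cast hzero u v hu
    linarith
  have hBmem (u v : ℤ) (hu : u ≠ 0) (h : IsCoprime u v) (he : 2 ∣ u) (hc : u.natAbs + v.natAbs ≤ C)
      (t : ℕ) (ht : t < T) (hs : ¬ Squarefree (u * (t : ℤ) + v)) : t ∈ B u v := by
    rw [mem_union]
    by_cases hn : u * (t : ℤ) + v = 0
    · right; simp [ht, hn]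
    · left
      obtain ⟨r, hr, hc, hd⟩ := key u v hu h he hc t ht hn hs
      rw [mem_biUnion]
      exact ⟨r, hr, by simp [hc, ht, hd]⟩
  have hcov : range T ⊆ range t₀ ∪ (B u₁ v₁ ∪ B u₂ v₂) := by
    intro t ht
    rw [mem_range] at ht
    simp only [mem_union (s := range t₀), mem_union (s := B u₁ v₁), mem_range]
    by_contra! hh
    obtain ⟨h1, h2, h3⟩ := hh
    refine hcon t h1 ?_ ?_
    · by_contra hs; exact h2 (hBmem u₁ v₁ hu₁ h₁ he₁ (by omega) t ht hs)
    · by_contra hs; exact h3 (hBmem u₂ v₂ hu₂ h₂ he₂ (by omega) t ht hs)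
  have h1 : (T : ℝ) ≤ t₀ + ((2 / 5 : ℝ) * T + R + 1 + ((2 / 5 : ℝ) * T + R + 1)) := by
    have := (card_le_card hcov).trans ((card_union_le _ _).trans
      (Nat.add_le_add_left (card_union_le _ _) _))
    rw [card_range, card_range] at this
    have := Nat.cast_le (α := ℝ).2 this
    push_cast at this
    linarith [hB u₁ v₁ hu₁, hB u₂ v₂ hu₂]
  have h2 : (T : ℝ) ≤ 5 * t₀ + 10 * R + 10 := by linarith
  have h3 : T ≤ 5 * t₀ + 10 * R + 10 := by exact_mod_cast h2
  have h4 : T = R * N := by simp only [T, R]; ring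
  have h5 : N ≤ R := by simp only [R]; nlinarith
  have h6 : N = 10 * C + 10 * (t₀ + 2) := rfl
  rw [h4] at h3
  have : R * (10 + 10 * (t₀ + 2)) ≤ R * N := by gcongr; omega
  nlinarith

open Polynomial in
theorem exists_irreducible_X_pow_sub_C_zmod {l m : ℕ} [Fact l.Prime] (hm : 0 < m)
    (h : l ≡ 1 [MOD m]) :
    ∃ g : ZMod l, g ≠ 0 ∧ Irreducible (X ^ m - C g : (ZMod l)[X]) := by
  have hl : l.Prime := Fact.out
  obtain ⟨g, hg⟩ := IsCyclic.exists_generator (α := (ZMod l)ˣ)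
  refine ⟨g, g.ne_zero, ?_⟩
  have hord : orderOf g = l - 1 := by
    rw [orderOf_eq_card_of_forall_mem_zpowers hg, Nat.card_eq_fintype_card, ZMod.card_units]
  obtain ⟨e, he⟩ : m ∣ l - 1 := (Nat.modEq_iff_dvd' hl.one_le).1 h.symm
  set f : (ZMod l)[X] := X ^ m - C (g : ZMod l) with hf
  have hfm : f.Monic := monic_X_pow_sub_C _ hm.ne'
  have hfd : f.natDegree = m := natDegree_X_pow_sub_C
  have hfu : ¬ IsUnit f := fun hu => by
    have := natDegree_eq_zero_of_isUnit hu
    omega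
  obtain ⟨P, hP, hPf⟩ := WfDvdMonoid.exists_irreducible_factor hfu hfm.ne_zero
  have : Fact (Irreducible P) := ⟨hP⟩
  have hP0 : P ≠ 0 := hP.ne_zero
  have : Module.Finite (ZMod l) (AdjoinRoot P) := (AdjoinRoot.powerBasis hP0).finite
  have : Finite (AdjoinRoot P) := Module.finite_of_finite (ZMod l)
  have : Fintype (AdjoinRoot P) := Fintype.ofFinite _
  set d := P.natDegree
  have hcard : Fintype.card (AdjoinRoot P) = l ^ d := by
    rw [Module.card_eq_pow_finrank (K := ZMod l), ZMod.card, (AdjoinRoot.powerBasis hP0).finrank,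
      AdjoinRoot.powerBasis_dim]
  set β := AdjoinRoot.root P
  have hβ : β ^ m = algebraMap (ZMod l) (AdjoinRoot P) g := by
    have : aeval β f = 0 := by
      obtain ⟨Q, hQ⟩ := hPf
      rw [hQ, map_mul, AdjoinRoot.aeval_eq, AdjoinRoot.mk_self, zero_mul]
    simpa [hf, sub_eq_zero] using this
  have hβ0 : β ≠ 0 := by
    rintro h0
    rw [h0, zero_pow hm.ne'] at hβ
    exact g.ne_zero ((map_eq_zero _).1 hβ.symm)
  have h1 : β ^ (l ^ d - 1) = 1 := by
    rw [← hcard]; exact FiniteField.pow_card_sub_one_eq_one β hβ0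
  let S := ∑ i ∈ Finset.range d, l ^ i
  have hS : l ^ d - 1 = m * (e * S) := by
    have := Nat.geomSum_eq hl.two_le d
    have h2 : (l - 1) ∣ l ^ d - 1 := by simpa using Nat.sub_dvd_pow_sub_pow l 1 d
    rw [← mul_assoc, ← he]
    simp only [S]
    rw [this, Nat.mul_div_cancel' h2]
  have h2 : g ^ (e * S) = 1 := by
    rw [hS, pow_mul, hβ, ← map_pow] at h1
    have := (algebraMap (ZMod l) (AdjoinRoot P)).injective (h1.trans (map_one _).symm)
    exact Units.ext (by simpa using this)
  have h3 : m ∣ S := by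
    have := orderOf_dvd_of_pow_eq_one h2
    rw [hord, he, mul_comm m e] at this
    refine Nat.dvd_of_mul_dvd_mul_left (Nat.pos_of_ne_zero ?_) this
    rintro rfl
    have := hl.two_le
    omega
  have h4 : m ∣ d := by
    have : S ≡ d [MOD m] := by
      have : S ≡ ∑ i ∈ Finset.range d, 1 [MOD m] := by
        simp only [S]
        refine Nat.ModEq.sum fun i _ => ?_
        simpa using h.pow i
      simpa using this
    exact (this.dvd_iff dvd_rfl).1 h3
  have h5 : m ≤ d := Nat.le_of_dvd hP.natDegree_pos h4
  have h6 : Associated P f := by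
    refine associated_of_dvd_of_natDegree_le hPf hfm.ne_zero ?_
    omega
  exact h6.irreducible hP

open Polynomial NumberField in
theorem mem_adjoin_of_smul_mem_of_isEisensteinAt {F : Type*} [Field F] [NumberField F]
    {B : PowerBasis ℚ F} (hB : IsIntegral ℤ B.gen) {s : ℤ}
    (hE : ∀ q : ℤ, Prime q → q ∣ s → (minpoly ℤ B.gen).IsEisensteinAt (Submodule.span ℤ {q}))
    (k : ℕ)
    {z : F} (hz : IsIntegral ℤ z) (h : s ^ k • z ∈ Algebra.adjoin ℤ {B.gen}) (hs : s ≠ 0) :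
    z ∈ Algebra.adjoin ℤ {B.gen} := by
  suffices H : ∀ r : ℤ, r ≠ 0 → (∀ q, Prime q → q ∣ r → q ∣ s) → ∀ z : F, IsIntegral ℤ z →
      r • z ∈ Algebra.adjoin ℤ {B.gen} → z ∈ Algebra.adjoin ℤ {B.gen} from
    H _ (pow_ne_zero k hs) (fun q hq => hq.dvd_of_dvd_pow) z hz h
  intro r
  induction r using UniqueFactorizationMonoid.induction_on_prime with
  | h₁ => exact fun h => absurd rfl h
  | h₂ u hu =>
    intro _ _ z _ h
    obtain ⟨u, rfl⟩ := hu
    have := Subalgebra.smul_mem _ h ((u⁻¹ : ℤˣ) : ℤ)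
    rwa [smul_smul, Units.inv_mul, one_smul] at this
  | h₃ a q ha hq ih =>
    intro _ hqs z hz h
    refine ih ha (fun r hr hra => hqs r hr (hra.mul_left q)) z hz ?_
    refine mem_adjoin_of_smul_prime_smul_of_minpoly_isEisensteinAt (K := ℚ) hq hB (hz.smul a) ?_
      (hE q hq (hqs q hq (dvd_mul_right q a)))
    rwa [smul_smul]

open Polynomial NumberField in
theorem discr_eq_and_adjoin_eq_top {F : Type*} [Field F] [NumberField F]
    {B : PowerBasis ℚ F} {θ : 𝓞 F} (hθ : (θ : F) = B.gen) {s M D : ℤ} {k : ℕ}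
    (hE : ∀ q : ℤ, Prime q → q ∣ s → (minpoly ℤ B.gen).IsEisensteinAt (Submodule.span ℤ {q}))
    (hs : s ≠ 0) (hM : Squarefree M) (hMs : IsCoprime M s) (hD : Algebra.discr ℚ B.basis = D)
    (hDs : Associated D (s ^ k * M)) :
    NumberField.discr F = D ∧ Algebra.adjoin ℤ {θ} = ⊤ := by
  have hB : IsIntegral ℤ B.gen := hθ ▸ θ.2
  have hdisc (z : F) (hz : IsIntegral ℤ z) : M • z ∈ Algebra.adjoin ℤ {B.gen} := by
    have := Algebra.discr_mul_isIntegral_mem_adjoin ℚ (B := B) hB hz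
    rw [hD, Int.cast_smul_eq_zsmul] at this
    refine mem_adjoin_of_smul_mem_of_isEisensteinAt hB hE k (hz.smul M) ?_ hs
    obtain ⟨u, hu⟩ := hDs
    rw [smul_smul, ← hu, mul_comm, mul_smul]
    exact Subalgebra.smul_mem _ this (u : ℤ)
  have hrank : Module.finrank ℤ (𝓞 F) = B.dim := by
    rw [NumberField.RingOfIntegers.rank, B.finrank]
  let e : Module.Basis (Fin B.dim) ℤ (𝓞 F) := Module.finBasisOfFinrankEq ℤ (𝓞 F) hrank
  let v : Fin B.dim → 𝓞 F := fun i => θ ^ (i : ℕ)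
  have hmem (z : 𝓞 F) : M • z ∈ Submodule.span ℤ (Set.range v) := by
    classical
    have hdeg : (minpoly ℤ θ).natDegree = B.dim := by
      rw [← B.natDegree_minpoly, minpoly.isIntegrallyClosed_eq_field_fractions' ℚ hB,
        (minpoly.monic hB).natDegree_map, ← hθ, NumberField.RingOfIntegers.minpoly_coe]
    have h1 := Submodule.span_range_natDegree_eq_adjoin
      (minpoly.monic (NumberField.RingOfIntegers.isIntegral θ)) (minpoly.aeval ℤ θ)
    have h2 : M • z ∈ Algebra.adjoin ℤ {θ} := by
      have := hdisc z z.2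
      let φ : 𝓞 F →ₐ[ℤ] F := IsScalarTower.toAlgHom ℤ (𝓞 F) F
      have h3 : (Algebra.adjoin ℤ {θ}).map φ = Algebra.adjoin ℤ {B.gen} := by
        rw [AlgHom.map_adjoin_singleton, ← hθ]; rfl
      rw [← h3] at this
      obtain ⟨w, hw, hw'⟩ := this
      have : w = M • z := by
        apply NumberField.RingOfIntegers.ext
        exact hw'.trans (map_zsmul (algebraMap (𝓞 F) F) M z).symm
      rwa [← this]
    rw [← Subalgebra.mem_toSubmodule, ← h1] at h2
    refine Submodule.span_mono ?_ h2
    intro x hx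
    obtain ⟨i, hi, rfl⟩ := Finset.mem_image.1 (Finset.mem_coe.1 hx)
    exact ⟨⟨i, by rw [← hdeg]; exact Finset.mem_range.1 hi⟩, rfl⟩
  have hv : Algebra.discr ℤ v = (e.toMatrix v).det ^ 2 * NumberField.discr F := by
    rw [← NumberField.discr_eq_discr F e, ← Algebra.discr_of_matrix_vecMul,
      e.toMatrix_map_vecMul]
  have hvD : Algebra.discr ℤ v = D := by
    have : (Algebra.discr ℤ v : ℚ) = D := by
      rw [← hD, Algebra.discr_def, Algebra.discr_def,
        ← eq_intCast (Int.castRingHom ℚ), RingHom.map_det]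
      congr 1
      ext i j
      simp [Algebra.traceMatrix_apply, Algebra.traceForm_apply, Algebra.coe_trace_int, v, hθ]
    exact_mod_cast this
  have hdvd : (e.toMatrix v).det ∣ M ^ B.dim := by
    choose c hc using fun j => (Submodule.mem_span_range_iff_exists_fun ℤ).1 (hmem (e j))
    refine ⟨(Matrix.of fun i j => c j i).det, ?_⟩
    rw [← Matrix.det_mul]
    have : (e.toMatrix v) * (Matrix.of fun i j => c j i) = M • 1 := by
      ext i j
      have := congrArg (fun z => e.repr z i) (hc j)
      simp only [map_sum, map_smul, Finsupp.coe_finsetSum, Finset.sum_apply, Finsupp.smul_apply,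
        Module.Basis.repr_self] at this
      rw [Matrix.mul_apply]
      simp only [Module.Basis.toMatrix_apply, Matrix.of_apply]
      simp only [Matrix.smul_apply, Matrix.one_apply]
      rw [Finsupp.single_apply] at this
      simpa [mul_comm, eq_comm] using this
    rw [this, Matrix.det_smul, Matrix.det_one, Fintype.card_fin, mul_one]
  set d := (e.toMatrix v).det
  have hds : IsCoprime d (s ^ k) :=
    (hMs.pow_left (m := B.dim)).of_isCoprime_of_dvd_left hdvd |>.pow_right
  have hd2 : d * d ∣ M := by
    have h1 : d ^ 2 ∣ s ^ k * M := by
      rw [← hDs.dvd_iff_dvd_right, ← hvD, hv]; exact dvd_mul_right _ _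
    rw [← sq]
    exact (hds.pow_left).dvd_of_dvd_mul_left h1
  have hdu : IsUnit d := hM d hd2
  refine ⟨?_, ?_⟩
  · rw [← hvD, hv, Int.isUnit_sq hdu, one_mul]
  · have := ((e.is_basis_iff_det (v := v)).2 hdu).2
    rw [← Algebra.toSubmodule_eq_top, eq_top_iff, ← this, Submodule.span_le]
    rintro _ ⟨i, rfl⟩
    exact pow_mem (Algebra.self_mem_adjoin_singleton ℤ θ) _

theorem Polynomial.degree_C_mul_X_add_C_lt_succ {R : Type*} [CommRing R] {m : ℕ} (hm : 0 < m)
    (a b : R) : (C a * X + C b).degree < ((m + 1 : ℕ) : WithBot ℕ) :=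
  degree_linear_le.trans_lt (by exact_mod_cast Nat.lt_add_of_pos_left hm)

theorem Polynomial.monic_X_pow_succ_add_C_mul_X_add_C {R : Type*} [CommRing R] {m : ℕ}
    (hm : 0 < m) (a b : R) : (X ^ (m + 1) + C a * X + C b).Monic := by
  rw [add_assoc]
  exact monic_X_pow_add (degree_C_mul_X_add_C_lt_succ hm a b)

theorem Polynomial.natDegree_X_pow_succ_add_C_mul_X_add_C {R : Type*} [CommRing R] [Nontrivial R]
    {m : ℕ} (hm : 0 < m) (a b : R) : (X ^ (m + 1) + C a * X + C b).natDegree = m + 1 := by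
  rw [add_assoc, natDegree_add_eq_left_of_degree_lt, natDegree_X_pow]
  rw [degree_X_pow]
  exact degree_C_mul_X_add_C_lt_succ hm a b

/-- The norm of `f'(α)` for a root `α` of the trinomial `f = X ^ (m + 1) + s X + l s`. -/
theorem Algebra.discr_powerBasis_of_trinomial {K L : Type*} [Field K] [CharZero K] [Field L]
    [Algebra K L] [FiniteDimensional K L] (B : PowerBasis K L) {m : ℕ} (hm : 0 < m) {l s : K}
    (hl : l ≠ 0) (hs : s ≠ 0)
    (h : minpoly K B.gen = Polynomial.X ^ (m + 1) + Polynomial.C s * Polynomial.X +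
      Polynomial.C (l * s)) :
    Algebra.discr K B.basis = (-1) ^ ((m + 1) * m / 2) *
      (s ^ m * (((m : K) + 1) ^ (m + 1) * l ^ m + (-1) ^ m * (m : K) ^ m * s)) := by
  have hm0 : (m : K) ≠ 0 := by exact_mod_cast hm.ne'
  have hdeg : (minpoly K B.gen).natDegree = m + 1 := by
    rw [h, Polynomial.natDegree_X_pow_succ_add_C_mul_X_add_C hm]
  have hdim : B.dim = m + 1 := by rw [← B.natDegree_minpoly, hdeg]
  have hfin : Module.finrank K L = m + 1 := by rw [B.finrank, hdim]
  have hroot : B.gen ^ (m + 1) + s • B.gen + algebraMap K L (l * s) = 0 := by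
    have := minpoly.aeval K B.gen
    rw [h] at this
    simpa [Algebra.smul_def] using this
  have hgen : Algebra.norm K B.gen = (-1) ^ (m + 1) * (l * s) := by
    rw [Algebra.PowerBasis.norm_gen_eq_coeff_zero_minpoly, hdim, h]
    simp
  have hnorm (c : K) : Algebra.norm K (algebraMap K L c - B.gen) = c ^ (m + 1) + s * c + l * s := by
    rw [Algebra.norm_eq_matrix_det B.basis, map_sub, AlgHom.commutes,
      Matrix.algebraMap_eq_diagonal]
    have := Matrix.eval_charpoly (Algebra.leftMulMatrix B.basis B.gen) c
    rw [charpoly_leftMulMatrix, h] at this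
    simp at this
    rw [this]
    rfl
  set δ := Polynomial.aeval B.gen (Polynomial.derivative (minpoly K B.gen)) with hδ
  have hδ' : δ = (m + 1) * B.gen ^ m + algebraMap K L s := by
    rw [hδ, h]; simp
  have hmul : B.gen * δ = algebraMap K L (s * m) * 
      (algebraMap K L (-((m + 1) * l) / m) - B.gen) := by
    have hc : algebraMap K L m * algebraMap K L (-((m + 1) * l) / m) =
        algebraMap K L (-((m + 1) * l)) := by
      rw [← map_mul, mul_div_cancel₀ _ hm0]
    rw [hδ']
    simp only [Algebra.smul_def, map_mul, map_neg, map_add, map_one, map_natCast] at hroot hc ⊢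
    linear_combination ((m : L) + 1) * hroot - algebraMap K L s * hc
  have hN : Algebra.norm K δ =
      s ^ m * (((m : K) + 1) ^ (m + 1) * l ^ m + (-1) ^ m * (m : K) ^ m * s) := by
    have := congrArg (Algebra.norm K) hmul
    rw [map_mul, map_mul, hgen, Algebra.norm_algebraMap, hnorm, hfin] at this
    have h0 : (-1) ^ (m + 1) * (l * s) ≠ 0 := by simp [hl, hs]
    apply mul_left_cancel₀ h0
    rw [this]
    set c : K := -((m + 1) * l) / m with hc
    have hcm : c * m = -((m + 1) * l) := div_mul_cancel₀ _ hm0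
    have h1 : (-1 : K) ^ m * (-1) ^ m = 1 := by rw [← mul_pow]; simp
    calc (s * m) ^ (m + 1) * (c ^ (m + 1) + s * c + l * s)
        = s ^ (m + 1) * ((c * m) ^ (m + 1) + m ^ m * s * (c * m) + m ^ (m + 1) * (l * s)) := by
          ring_nf
      _ = _ := by
        rw [hcm, neg_pow, mul_pow]
        linear_combination (l * s ^ (m + 2) * (m : K) ^ m) * h1
  rw [Algebra.discr_powerBasis_eq_norm, hfin, ← hδ, hN]
  rfl

section

open Polynomial

/-- The polynomial `X ^ (m + 1) + s X + l s`. -/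
noncomputable def eisensteinTrinomial (m : ℕ) (l s : ℤ) : ℤ[X] :=
  X ^ (m + 1) + C s * X + C (l * s)

/-- Up to sign and a power of `s`, the discriminant of `eisensteinTrinomial m l s`. -/
def trinomialDiscrFactor (m : ℕ) (l s : ℤ) : ℤ :=
  ((m : ℤ) + 1) ^ (m + 1) * l ^ m + (-1) ^ m * (m : ℤ) ^ m * s

theorem isCoprime_trinomialDiscrFactor {m : ℕ} {l s : ℤ} (hsl : IsCoprime s ((m + 1) * l)) :
    IsCoprime (trinomialDiscrFactor m l s) s := by
  rw [trinomialDiscrFactor]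
  exact IsCoprime.add_mul_right_left_iff.2
    (hsl.of_mul_right_left.symm.pow_left.mul_left hsl.of_mul_right_right.symm.pow_left)

theorem isCoprime_trinomialDiscrFactor_mul {m : ℕ} (hm : 0 < m) {l s : ℤ}
    (hl : IsCoprime l (m : ℤ)) (hs : IsCoprime s ((m + 1) * l)) :
    IsCoprime (trinomialDiscrFactor m l s) (m * (m + 1) * l) := by
  rw [trinomialDiscrFactor]
  have hm1 : IsCoprime ((m : ℤ) + 1) m := ⟨1, -1, by ring⟩
  have hu : IsUnit ((-1 : ℤ) ^ m) := (isUnit_one.neg).pow m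
  have h1 : IsCoprime s ((m : ℤ) + 1) := hs.of_mul_right_left
  have h2 : IsCoprime s l := hs.of_mul_right_right
  have h3 : IsCoprime ((m : ℤ) ^ m) ((m : ℤ) + 1) := hm1.symm.pow_left
  have h4 : IsCoprime ((m : ℤ) ^ m) l := hl.symm.pow_left
  have key {d e x : ℤ} (hd : d ∣ x) (he : IsCoprime e d) : IsCoprime (e + x) d := by
    obtain ⟨c, rfl⟩ := hd
    exact he.add_mul_left_left c
  have hmm : (m : ℤ) ∣ (m : ℤ) ^ m := dvd_pow_self _ hm.ne'
  refine ((key ?_ ?_).mul_right ?_).mul_right ?_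
  · exact (hmm.mul_left _).mul_right _
  · exact hm1.pow_left.mul_left hl.pow_left
  · rw [add_comm]
    refine key ((dvd_pow_self _ (by omega)).mul_right _) ?_
    exact ((isCoprime_mul_unit_left_left hu _ _).2 h3).mul_left h1
  · rw [add_comm]
    refine key ((dvd_pow_self _ hm.ne').mul_left _) ?_
    exact ((isCoprime_mul_unit_left_left hu _ _).2 h4).mul_left h2

namespace eisensteinTrinomial

variable {m : ℕ} {l s : ℤ}

theorem monic (hm : 0 < m) : (eisensteinTrinomial m l s).Monic :=
  monic_X_pow_succ_add_C_mul_X_add_C hm s (l * s)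

theorem natDegree (hm : 0 < m) : (eisensteinTrinomial m l s).natDegree = m + 1 :=
  natDegree_X_pow_succ_add_C_mul_X_add_C hm s (l * s)

theorem isEisensteinAt (hm : 0 < m) (hs : Squarefree s) (hsl : IsCoprime s l) {q : ℤ}
    (hq : Prime q) (hqs : q ∣ s) :
    (eisensteinTrinomial m l s).IsEisensteinAt (Ideal.span {q}) where
  leading := by
    rw [(monic hm).leadingCoeff, Ideal.mem_span_singleton]
    exact fun h => hq.not_isUnit (isUnit_of_dvd_one h)
  mem := fun {n} hn => by
    rw [natDegree hm] at hn
    rw [Ideal.mem_span_singleton, eisensteinTrinomial, coeff_add, coeff_add, coeff_X_pow,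
      if_neg hn.ne, zero_add, coeff_C_mul, coeff_C]
    refine dvd_add (hqs.mul_right _) ?_
    split_ifs
    · exact hqs.mul_left _
    · exact dvd_zero _
  notMem := by
    rw [Ideal.span_singleton_pow, Ideal.mem_span_singleton]
    intro h
    have : q ^ 2 ∣ l * s := by simpa [eisensteinTrinomial] using h
    have hql : IsCoprime (q ^ 2) l := (hsl.of_isCoprime_of_dvd_left hqs).pow_left
    have := hql.dvd_of_dvd_mul_left this
    exact hq.not_isUnit (hs q (by rwa [← sq]))

theorem irreducible (hm : 0 < m) (hs : Squarefree s) (hsl : IsCoprime s l) (hs1 : ¬ IsUnit s) :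
    Irreducible (eisensteinTrinomial m l s) := by
  obtain ⟨q, hq, hqs⟩ := WfDvdMonoid.exists_irreducible_factor hs1 hs.ne_zero
  refine (isEisensteinAt hm hs hsl hq.prime hqs).irreducible ?_ (monic hm).isPrimitive ?_
  · exact (Ideal.span_singleton_prime hq.ne_zero).2 hq.prime
  · rw [natDegree hm]; omega

theorem irreducible_map (hm : 0 < m) (hs : Squarefree s) (hsl : IsCoprime s l) (hs1 : ¬ IsUnit s) :
    Irreducible ((eisensteinTrinomial m l s).map (algebraMap ℤ ℚ)) :=
  ((monic hm).irreducible_iff_irreducible_map_fraction_map).1 (irreducible hm hs hsl hs1)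

theorem minpoly_rat_eq {L : Type*} [Field L] [CharZero L] (hm : 0 < m) (hs : Squarefree s)
    (hsl : IsCoprime s l) (hs1 : ¬ IsUnit s) {α : L}
    (hα : aeval α (eisensteinTrinomial m l s) = 0) :
    minpoly ℚ α = (eisensteinTrinomial m l s).map (algebraMap ℤ ℚ) :=
  (minpoly.eq_of_irreducible_of_monic (irreducible_map hm hs hsl hs1)
    (by rwa [aeval_map_algebraMap]) ((monic hm).map _)).symm

open NumberField

theorem discr_eq_and_adjoin_eq_top {F : Type*} [Field F] [NumberField F] (hm : 0 < m) (hl : l ≠ 0)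
    (hs : Squarefree s) (hs1 : ¬ IsUnit s) (hsl : IsCoprime s ((m + 1) * l))
    (hM : Squarefree (trinomialDiscrFactor m l s))
    (hF : Module.finrank ℚ F = m + 1) {θ : 𝓞 F} (hθ : aeval θ (eisensteinTrinomial m l s) = 0) :
    NumberField.discr F = (-1) ^ ((m + 1) * m / 2) * (s ^ m * trinomialDiscrFactor m l s) ∧
      Algebra.adjoin ℤ {θ} = ⊤ := by
  have hsl' := hsl.of_mul_right_right
  have hα : aeval (θ : F) (eisensteinTrinomial m l s) = 0 := by
    rw [aeval_algebraMap_apply, hθ, map_zero]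
  have hmin := minpoly_rat_eq hm hs hsl' hs1 hα
  have hθint : IsIntegral ℚ (θ : F) := Algebra.IsIntegral.isIntegral _
  have htop : IntermediateField.adjoin ℚ {(θ : F)} = ⊤ := by
    rw [Field.primitive_element_iff_minpoly_natDegree_eq, hmin, (monic hm).natDegree_map,
      natDegree hm, hF]
  have htop' : Algebra.adjoin ℚ {(θ : F)} = ⊤ := by
    rw [← IntermediateField.adjoin_simple_toSubalgebra_of_isAlgebraic hθint.isAlgebraic, htop,
      IntermediateField.top_toSubalgebra]
  let B := PowerBasis.ofAdjoinEqTop hθint htop'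
  have hB : (θ : F) = B.gen := (PowerBasis.ofAdjoinEqTop_gen hθint htop').symm
  have hminZ : minpoly ℤ B.gen = eisensteinTrinomial m l s := by
    apply Polynomial.map_injective (algebraMap ℤ ℚ) (algebraMap ℤ ℚ).injective_int
    rw [← hmin, ← hB, minpoly.isIntegrallyClosed_eq_field_fractions' ℚ
      (RingOfIntegers.isIntegral_coe θ)]
  refine _root_.discr_eq_and_adjoin_eq_top hB (s := s) (M := trinomialDiscrFactor m l s) (k := m)
    ?_ hs.ne_zero hM ?_ ?_ ?_
  · intro q hq hqs
    rw [hminZ]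
    exact isEisensteinAt hm hs hsl' hq hqs
  · exact isCoprime_trinomialDiscrFactor hsl
  · have := Algebra.discr_powerBasis_of_trinomial B hm (l := (l : ℚ)) (s := (s : ℚ))
      (by exact_mod_cast hl) (by exact_mod_cast hs.ne_zero)
      (by rw [← hB, hmin, eisensteinTrinomial]; simp)
    rw [this, trinomialDiscrFactor]
    push_cast
    rfl
  · exact associated_unit_mul_left _ _ ((isUnit_one.neg).pow _)

end eisensteinTrinomial

theorem Int.isCoprime_prime_iff {p : ℕ} (hp : p.Prime) (x : ℤ) :
    IsCoprime x p ↔ (x : ZMod p) ≠ 0 := by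
  rw [isCoprime_comm, (Nat.prime_iff_prime_int.1 hp).irreducible.coprime_iff_not_dvd, Ne,
    ZMod.intCast_zmod_eq_zero_iff_dvd]

theorem exists_parameters {m p : ℕ} [Fact p.Prime] (hm : 0 < m) (hp : 16 * (m * (m + 1)) ^ 4 < p)
    {k : ℤ} (hk : ¬ (p : ℤ) ∣ k) :
    ∃ (l : ℕ) (s : ℤ), l.Prime ∧ 1 < s ∧ Squarefree s ∧ IsCoprime (l : ℤ) (m : ℤ) ∧
      IsCoprime s ((m + 1) * l) ∧
      Squarefree (trinomialDiscrFactor m l s) ∧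
      ¬ IsUnit (trinomialDiscrFactor m l s) ∧
      Irreducible (X ^ m + C (s : ZMod l) : (ZMod l)[X]) ∧
      (-1) ^ ((m + 1) * m / 2) * (s ^ m * trinomialDiscrFactor m l s) ≡ k [ZMOD p] := by
  have hpp : p.Prime := Fact.out
  have hN : 0 < m * (m + 1) := by positivity
  have hpm : m * (m + 1) < p := by
    have : m * (m + 1) ≤ (m * (m + 1)) ^ 4 := Nat.le_self_pow (by norm_num) _
    omega
  have hmp : m < p := by nlinarith
  have hNp : Nat.Coprime (m * (m + 1)) p :=
    (Nat.coprime_of_lt_prime hN.ne' hpm hpp).symm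
  have hm0 : (m : ZMod p) ≠ 0 := by
    rw [Ne, ZMod.natCast_eq_zero_iff]; exact Nat.not_dvd_of_pos_of_lt hm hmp
  have hm10 : (m : ZMod p) + 1 ≠ 0 := by
    have : ((m * (m + 1) : ℕ) : ZMod p) ≠ 0 := by
      rw [Ne, ZMod.natCast_eq_zero_iff]; exact Nat.not_dvd_of_pos_of_lt hN hpm
    push_cast at this
    exact right_ne_zero_of_mul this
  have hk0 : (k : ZMod p) ≠ 0 := by rwa [Ne, ZMod.intCast_zmod_eq_zero_iff_dvd]
  set σ : ℤ := (-1) ^ ((m + 1) * m / 2) with hσ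
  have hσ2 : σ * σ = 1 := by rw [hσ, ← mul_pow]; norm_num
  have hσ2' : (σ : ZMod p) * σ = 1 := by exact_mod_cast congrArg (Int.cast : ℤ → ZMod p) hσ2
  have hσ0 : (σ : ZMod p) ≠ 0 := left_ne_zero_of_mul_eq_one hσ2'
  obtain ⟨y, x, hy, hx, hxy⟩ := exists_mul_pow_add_mul_pow_eq hN hp
    (a := ((m : ZMod p) + 1) ^ (m + 1)) (b := (-1) ^ m * (m : ZMod p) ^ m) (c := σ * k)
    (pow_ne_zero _ hm10) (mul_ne_zero (pow_ne_zero _ (neg_ne_zero.2 one_ne_zero))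
      (pow_ne_zero _ hm0)) (mul_ne_zero hσ0 hk0)
  set b : ZMod p := y ^ (m + 1) / x ^ m
  have hb0 : b ≠ 0 := div_ne_zero (pow_ne_zero _ hy) (pow_ne_zero _ hx)
  have hab : x ^ m * b = y ^ (m + 1) := mul_div_cancel₀ _ (pow_ne_zero _ hx)
  have hmpc : Nat.Coprime m p := hNp.coprime_mul_right
  -- the prime `l`
  obtain ⟨c, hc1, hc2⟩ := Nat.chineseRemainder hmpc 1 b.val
  obtain ⟨l, hlgt, hl, hlmod⟩ := Nat.forall_exists_prime_gt_and_modEq (a := c) (m * (m + 1) * p)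
    (q := m * p) (mul_pos hm hpp.pos).ne' (by
      refine Nat.Coprime.mul_right ?_ ?_
      · exact (hc1.gcd_eq).trans (by simp)
      · refine (Nat.coprime_comm.1 ((Nat.Prime.coprime_iff_not_dvd hpp).2 ?_))
        rw [← ZMod.natCast_eq_zero_iff, (ZMod.natCast_eq_natCast_iff _ _ _).2 hc2]
        simpa using hb0)
  have : Fact l.Prime := ⟨hl⟩
  have hlm : l ≡ 1 [MOD m] := (hlmod.of_mul_right _).trans hc1
  have hlp : (l : ZMod p) = b := by
    rw [(ZMod.natCast_eq_natCast_iff _ _ _).2 ((hlmod.of_mul_left _).trans hc2)]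
    simp
  have hlN : Nat.Coprime (m * (m + 1) * p) l :=
    (Nat.coprime_of_lt_prime (mul_pos hN hpp.pos).ne' hlgt hl).symm
  obtain ⟨g, hg0, hg⟩ := exists_irreducible_X_pow_sub_C_zmod hm hlm
  -- the residue class of `s`
  obtain ⟨c₁, hc₁, hc₁'⟩ := Nat.chineseRemainder hNp 1 (x ^ m).val
  obtain ⟨s₀, hs₀, hs₀'⟩ := Nat.chineseRemainder hlN c₁ (-g).val
  have hs₀N : s₀ ≡ 1 [MOD m * (m + 1)] := (hs₀.of_mul_right _).trans hc₁
  have hs₀p : (s₀ : ZMod p) = x ^ m := by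
    rw [(ZMod.natCast_eq_natCast_iff _ _ _).2 ((hs₀.of_mul_left _).trans hc₁')]
    simp
  have hs₀l : (s₀ : ZMod l) = -g := by
    rw [(ZMod.natCast_eq_natCast_iff _ _ _).2 hs₀']
    simp
  have hcN : IsCoprime (s₀ : ℤ) ((m : ℤ) * (m + 1)) := by
    have : Nat.Coprime s₀ (m * (m + 1)) := (hs₀N.gcd_eq).trans (by simp)
    exact_mod_cast Nat.isCoprime_iff_coprime.2 this
  have hcp : IsCoprime (s₀ : ℤ) p := by
    rw [Int.isCoprime_prime_iff hpp]; simpa [hs₀p] using pow_ne_zero m hx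
  have hcl : IsCoprime (s₀ : ℤ) l := by
    rw [Int.isCoprime_prime_iff hl]; simpa [hs₀l] using hg0
  have hlm' : IsCoprime (l : ℤ) (m : ℤ) :=
    Nat.isCoprime_iff_coprime.2 (hlN.coprime_mul_right.coprime_mul_right.symm)
  have hs₀' : IsCoprime (s₀ : ℤ) ((m + 1) * l) := hcN.of_mul_right_right.mul_right hcl
  set P : ℤ → ℤ := fun s => ((m : ℤ) + 1) ^ (m + 1) * (l : ℤ) ^ m + (-1) ^ m * (m : ℤ) ^ m * s
    with hP
  have hPp {s : ℤ} (hs : (s : ZMod p) = x ^ m) : (s : ZMod p) ^ m * (P s : ZMod p) = σ * k := by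
    rw [← hxy, hP]
    push_cast
    rw [hlp, hs]
    calc _ = ((m : ZMod p) + 1) ^ (m + 1) * (x ^ m * b) ^ m +
          (-1) ^ m * (m : ZMod p) ^ m * x ^ (m * (m + 1)) := by ring
      _ = _ := by rw [hab]; ring
  have hPcp : IsCoprime (P s₀) (p : ℤ) := by
    rw [Int.isCoprime_prime_iff hpp]
    exact right_ne_zero_of_mul ((hPp (by simpa using hs₀p)).trans_ne (mul_ne_zero hσ0 hk0))
  set W : ℤ := m * (m + 1) * l * p with hW
  have hl0 : 0 < (l : ℤ) := mod_cast hl.pos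
  have hp0 : 0 < (p : ℤ) := mod_cast hpp.pos
  have hm0' : 0 < (m : ℤ) := mod_cast hm
  have hW0 : 0 < W := by positivity
  have hW2 : 2 ∣ W := by
    have : (2 : ℤ) ∣ m * (m + 1) := (Int.even_mul_succ_self m).two_dvd
    exact (this.mul_right _).mul_right _
  have hU0 : (-1) ^ m * (m : ℤ) ^ m * W ≠ 0 := by positivity
  have hcs : IsCoprime W s₀ := by
    refine IsCoprime.symm ?_
    exact (hcN.mul_right hcl).mul_right hcp
  have hcP0 : IsCoprime (P s₀) W := (isCoprime_trinomialDiscrFactor_mul hm hlm' hs₀').mul_right hPcp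
  have hcP : IsCoprime ((-1) ^ m * (m : ℤ) ^ m * W) (P s₀) := by
    refine IsCoprime.mul_left ?_ hcP0.symm
    rw [isCoprime_mul_unit_left_left ((isUnit_one.neg).pow m)]
    exact (hcP0.of_mul_right_left.of_mul_right_left.of_mul_right_left).symm.pow_left
  obtain ⟨t, ht, hts, htP⟩ := exists_squarefree_pair hW0.ne' hU0 hcs hcP hW2 (hW2.mul_left _)
    ((P s₀).natAbs + 2)
  have hPs : P (W * t + s₀) = (-1) ^ m * (m : ℤ) ^ m * W * t + P s₀ := by rw [hP]; ring
  have hsp : ((W * t + s₀ : ℤ) : ZMod p) = x ^ m := by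
    rw [hW]; push_cast; rw [hs₀p]; simp
  have hsl : ((W * t + s₀ : ℤ) : ZMod l) = - g := by
    rw [hW]; push_cast; rw [hs₀l]; simp
  refine ⟨l, W * t + s₀, hl, ?_, hts, hlm', ?_, ?_, ?_, ?_, ?_⟩
  · have : (2 : ℤ) ≤ t := by omega
    nlinarith
  · have : (W * t + s₀ : ℤ) = s₀ + (m + 1) * l * (m * p * t) := by rw [hW]; ring
    rw [this]
    exact hs₀'.add_mul_left_left _
  · change Squarefree (P _)
    rwa [hPs]
  · change ¬ IsUnit (P _)
    rw [hPs, Int.isUnit_iff_natAbs_eq]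
    intro h
    have h1 : ((-1) ^ m * (m : ℤ) ^ m * W * t).natAbs ≤ 1 + (P s₀).natAbs := by omega
    have h2 : t ≤ ((-1) ^ m * (m : ℤ) ^ m * W * t).natAbs := by
      rw [Int.natAbs_mul _ (t : ℤ), Int.natAbs_natCast]
      exact Nat.le_mul_of_pos_left _ (Int.natAbs_pos.2 hU0)
    omega
  · rw [hsl]; simpa [sub_eq_add_neg] using hg
  · change σ * (_ * P _) ≡ k [ZMOD p]
    rw [← ZMod.intCast_eq_intCast_iff]
    have := hPp hsp
    push_cast at this ⊢
    rw [this, ← mul_assoc, hσ2', one_mul]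

namespace eisensteinTrinomial

variable {m : ℕ} {s : ℤ}

theorem irreducible_divByMonic {O : Type*} [CommRing O] [IsDomain O] [CharZero O] {l : ℕ}
    [Fact l.Prime] (hm : 0 < m) (hs : Squarefree s) (hs1 : ¬ IsUnit s) (hsl : IsCoprime s l)
    (hirr : Irreducible (X ^ m + C (s : ZMod l) : (ZMod l)[X])) {θ : O}
    (hθ : aeval θ (eisensteinTrinomial m l s) = 0) (htop : Algebra.adjoin ℤ {θ} = ⊤) :
    ((eisensteinTrinomial m l s).map (algebraMap ℤ O) /ₘ (X - C θ)).Monic ∧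
      Irreducible ((eisensteinTrinomial m l s).map (algebraMap ℤ O) /ₘ (X - C θ)) := by
  set f := eisensteinTrinomial m l s with hf
  have hfm : f.Monic := monic hm
  have hθint : IsIntegral ℤ θ := ⟨f, hfm, hθ⟩
  have hmin : minpoly ℤ θ = f := by
    have hd := minpoly.isIntegrallyClosed_dvd hθint hθ
    refine eq_of_monic_of_associated (minpoly.monic hθint) hfm ?_
    exact (((irreducible hm hs hsl hs1).dvd_iff.1 hd).resolve_left (minpoly.not_isUnit ℤ θ)).symm
  let B := PowerBasis.ofAdjoinEqTop' hθint htop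
  have hB : B.gen = θ := PowerBasis.ofAdjoinEqTop'_gen hθint htop
  let φ : O →ₐ[ℤ] ZMod l := B.lift 0 (by
    rw [hB, hmin, hf, eisensteinTrinomial]
    simp)
  have hφ : φ θ = 0 := by rw [← hB]; exact B.lift_gen 0 _
  set g := f.map (algebraMap ℤ O) /ₘ (X - C θ)
  have hmul : (X - C θ) * g = f.map (algebraMap ℤ O) := by
    rw [mul_divByMonic_eq_iff_isRoot, IsRoot.def, eval_map_algebraMap, hθ]
  have hgm : g.Monic := (monic_X_sub_C θ).of_mul_monic_left (hmul ▸ hfm.map _)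
  refine ⟨hgm, hgm.irreducible_of_irreducible_map (φ : O →+* ZMod l) g ?_⟩
  have h2 : g.map (φ : O →+* ZMod l) = X ^ m + C (s : ZMod l) := by
    apply mul_left_cancel₀ (X_ne_zero (R := ZMod l))
    have : X * g.map (φ : O →+* ZMod l) = ((X - C θ) * g).map (φ : O →+* ZMod l) := by
      simp [hφ]
    rw [this, hmul, Polynomial.map_map, hf, eisensteinTrinomial]
    simp
    ring
  rwa [h2]

open NumberField

theorem exists_root_adjoin {K : Type*} [Field K] [NumberField K] {l : ℤ} (hm : 0 < m)
    (hs : Squarefree s) (hsl : IsCoprime s l) (hs1 : ¬ IsUnit s) {α : K}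
    (hα : aeval α (eisensteinTrinomial m l s) = 0) :
    Module.finrank ℚ (IntermediateField.adjoin ℚ {α}) = m + 1 ∧
      ∃ θ : 𝓞 (IntermediateField.adjoin ℚ {α}),
        algebraMap (IntermediateField.adjoin ℚ {α}) K θ = α ∧
          aeval θ (eisensteinTrinomial m l s) = 0 := by
  refine ⟨?_, ?_⟩
  · rw [IntermediateField.adjoin.finrank (Algebra.IsIntegral.isIntegral α),
      minpoly_rat_eq hm hs hsl hs1 hα, (monic hm).natDegree_map, natDegree hm]
  let F := IntermediateField.adjoin ℚ {α}
  let θ : F := IntermediateField.AdjoinSimple.gen ℚ α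
  have hθα : algebraMap F K θ = α := IntermediateField.AdjoinSimple.algebraMap_gen ℚ α
  have hθ : aeval θ (eisensteinTrinomial m l s) = 0 := by
    apply (algebraMap F K).injective
    rw [← aeval_algebraMap_apply, hθα, hα, map_zero]
  let θ' : 𝓞 F := ⟨θ, eisensteinTrinomial m l s, monic hm, hθ⟩
  have hθ' : aeval θ' (eisensteinTrinomial m l s) = 0 := by
    apply RingOfIntegers.coe_injective
    rw [← aeval_algebraMap_apply, map_zero]
    exact hθ
  exact ⟨θ', hθα, hθ'⟩

theorem exists_algEquiv_apply_eq {K : Type*} [Field K] [NumberField K] [IsGalois ℚ K] {l : ℕ}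
    [Fact l.Prime] (hm : 0 < m) (hs : Squarefree s) (hs1 : ¬ IsUnit s)
    (hsl : IsCoprime s ((m + 1) * l))
    (hM : Squarefree (trinomialDiscrFactor m l s))
    (hirr : Irreducible (X ^ m + C (s : ZMod l) : (ZMod l)[X])) {α β γ : K}
    (hα : aeval α (eisensteinTrinomial m l s) = 0) (hβ : aeval β (eisensteinTrinomial m l s) = 0)
    (hγ : aeval γ (eisensteinTrinomial m l s) = 0) (hβα : β ≠ α) (hγα : γ ≠ α) :
    ∃ σ : K ≃ₐ[ℚ] K, σ α = α ∧ σ β = γ := by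
  have hsl' := hsl.of_mul_right_right
  have hl0 : (l : ℤ) ≠ 0 := by exact_mod_cast (Fact.out : l.Prime).ne_zero
  set f := eisensteinTrinomial m l s
  obtain ⟨hfin, θ, hθα, hθ⟩ := exists_root_adjoin hm hs hsl' hs1 hα
  let F := IntermediateField.adjoin ℚ {α}
  have htop := (discr_eq_and_adjoin_eq_top hm hl0 hs hs1 hsl hM hfin hθ).2
  obtain ⟨hgm, hgi⟩ := irreducible_divByMonic hm hs hs1 hsl' hirr hθ htop
  set g := f.map (algebraMap ℤ (𝓞 F)) /ₘ (X - C θ)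
  have hmul : (X - C θ) * g = f.map (algebraMap ℤ (𝓞 F)) := by
    rw [mul_divByMonic_eq_iff_isRoot, IsRoot.def, eval_map_algebraMap, hθ]
  have hgF : Irreducible (g.map (algebraMap (𝓞 F) F)) :=
    (hgm.irreducible_iff_irreducible_map_fraction_map).1 hgi
  have key {x : K} (hx : aeval x f = 0) (hxα : x ≠ α) :
      minpoly F x = g.map (algebraMap (𝓞 F) F) := by
    refine (minpoly.eq_of_irreducible_of_monic hgF ?_ (hgm.map _)).symm
    rw [aeval_map_algebraMap]
    have h1 : aeval x ((X - C θ) * g) = 0 := by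
      rw [hmul, aeval_map_algebraMap, hx]
    rw [map_mul, mul_eq_zero] at h1
    refine h1.resolve_left ?_
    rw [map_sub, aeval_X, aeval_C, sub_eq_zero]
    intro h
    exact hxα (h.trans hθα)
  have hnorm : Normal F K := inferInstance
  obtain ⟨τ, hτ⟩ := (isConjRoot_iff_exists_algEquiv (K := F) (x := γ) (y := β)).1
    ((key hγ hγα).trans (key hβ hβα).symm)
  refine ⟨τ.restrictScalars ℚ, ?_, hτ⟩
  change τ α = α
  rw [← hθα, τ.commutes]

theorem isMultiplyPretransitive_rootSet {K : Type*} [Field K] [NumberField K] [IsGalois ℚ K] {l : ℕ}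
    [Fact l.Prime] (hm : 0 < m) (hs : Squarefree s) (hs1 : ¬ IsUnit s)
    (hsl : IsCoprime s ((m + 1) * l))
    (hM : Squarefree (trinomialDiscrFactor m l s))
    (hirr : Irreducible (X ^ m + C (s : ZMod l) : (ZMod l)[X])) :
    MulAction.IsMultiplyPretransitive (K ≃ₐ[ℚ] K)
      ((eisensteinTrinomial m l s).rootSet (𝓞 K)) 2 := by
  have hsl' := hsl.of_mul_right_right
  set f := eisensteinTrinomial m l s
  have hroot (x : f.rootSet (𝓞 K)) : aeval ((x : 𝓞 K) : K) f = 0 := by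
    rw [aeval_algebraMap_apply, aeval_eq_zero_of_mem_rootSet x.2, map_zero]
  have hcoe (σ : K ≃ₐ[ℚ] K) (x : f.rootSet (𝓞 K)) :
      (((σ • x : f.rootSet (𝓞 K)) : 𝓞 K) : K) = σ ((x : 𝓞 K) : K) := by
    rw [rootSet.coe_smul]; rfl
  have hext {x y : f.rootSet (𝓞 K)} : ((x : 𝓞 K) : K) = ((y : 𝓞 K) : K) ↔ x = y := by
    rw [← Subtype.coe_inj, RingOfIntegers.coe_injective.eq_iff]
  rw [MulAction.is_two_pretransitive_iff]
  intro a b c d hab hcd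
  have h1 : IsConjRoot ℚ ((c : 𝓞 K) : K) ((a : 𝓞 K) : K) :=
    (minpoly_rat_eq hm hs hsl' hs1 (hroot c)).trans (minpoly_rat_eq hm hs hsl' hs1 (hroot a)).symm
  obtain ⟨σ, hσ⟩ := isConjRoot_iff_exists_algEquiv.1 h1
  have hσ' : σ • a = c := hext.1 (by rw [hcoe, hσ])
  obtain ⟨τ, hτ1, hτ2⟩ := exists_algEquiv_apply_eq hm hs hs1 hsl hM hirr (hroot c)
    (hroot (σ • b)) (hroot d)
    (fun h => hab (smul_left_cancel σ (hσ'.trans (hext.1 h).symm)))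
    (fun h => hcd (hext.1 h).symm)
  refine ⟨τ * σ, ?_, ?_⟩
  · rw [mul_smul, hσ']
    exact hext.1 (by rw [hcoe, hτ1])
  · rw [mul_smul]
    exact hext.1 (by rw [hcoe, hτ2])

end eisensteinTrinomial

namespace eisensteinTrinomial

variable {m : ℕ} {l s : ℤ}

theorem card_roots_map_le {κ : Type*} [CommRing κ] [IsDomain κ] [DecidableEq κ]
    (φ : ℤ →+* κ) (h : ((m * (m + 1) * l * s : ℤ) : κ) ≠ 0) :
    Multiset.card ((eisensteinTrinomial m l s).map φ).roots ≤
      ((eisensteinTrinomial m l s).map φ).roots.toFinset.card + 1 := by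
  set F := (eisensteinTrinomial m l s).map φ with hF
  have hF' : F = X ^ (m + 1) + C (s : κ) * X + C (l * s : κ) := by
    rw [hF, eisensteinTrinomial]; simp
  push_cast at h
  have hs : (s : κ) ≠ 0 := right_ne_zero_of_mul h
  have hl : (l : κ) ≠ 0 := right_ne_zero_of_mul (left_ne_zero_of_mul h)
  have hm1 : (m : κ) + 1 ≠ 0 := right_ne_zero_of_mul (left_ne_zero_of_mul (left_ne_zero_of_mul h))
  have hm0 : (m : κ) ≠ 0 := left_ne_zero_of_mul (left_ne_zero_of_mul (left_ne_zero_of_mul h))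
  have hm : 0 < m := Nat.pos_of_ne_zero (by rintro rfl; simp at hm0)
  have hF0 : F ≠ 0 := ((monic hm).map _).ne_zero
  have hdouble {x : κ} (hx : 1 < F.rootMultiplicity x) : (m : κ) * x = -((m + 1) * l) := by
    obtain ⟨h1, h2⟩ := (one_lt_rootMultiplicity_iff_isRoot hF0).1 hx
    rw [IsRoot.def, hF'] at h1 h2
    simp only [eval_add, eval_pow, eval_X, eval_mul, eval_C, derivative_add, derivative_X_pow,
      derivative_C_mul, derivative_X, derivative_C, add_tsub_cancel_right,
      Nat.cast_add, Nat.cast_one, mul_one, add_zero] at h1 h2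
    apply mul_left_cancel₀ hs
    linear_combination (m + 1 : κ) * h1 - x * h2
  have htriple (x : κ) : F.rootMultiplicity x ≤ 2 := by
    by_contra! hx
    have h1 := hdouble (x := x) (by omega)
    have h2 := isRoot_iterate_derivative_of_lt_rootMultiplicity hx
    have hx0 : x ≠ 0 := by
      rintro rfl
      rw [mul_zero, eq_comm, neg_eq_zero] at h1
      exact mul_ne_zero hm1 hl h1
    rw [IsRoot.def, hF'] at h2
    simp [derivative_X_pow, hx0, hm1, hm0] at h2
  by_cases hex : ∃ r, 1 < F.rootMultiplicity r
  · obtain ⟨r, hr⟩ := hex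
    have hle : F.roots ≤ F.roots.toFinset.val + {r} := by
      rw [Multiset.le_iff_count]
      intro x
      rw [count_roots, Multiset.count_add, Multiset.count_singleton]
      by_cases hx : F.rootMultiplicity x = 0
      · omega
      have hx1 : Multiset.count x F.roots.toFinset.val = 1 := by
        rw [Multiset.toFinset_val, Multiset.count_dedup, if_pos]
        rw [← Multiset.count_pos, count_roots]
        omega
      rw [hx1]
      split_ifs with hxr
      · exact htriple x
      · by_contra! hx2
        refine hxr (mul_left_cancel₀ hm0 ?_)
        rw [hdouble hr, hdouble (by omega)]
    exact (Multiset.card_le_card hle).trans_eq (by rw [Multiset.card_add, Multiset.card_singleton,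
      Finset.card_val])
  · push Not at hex
    have : F.roots.Nodup := Multiset.nodup_iff_count_le_one.2 fun x => by
      rw [count_roots]; exact hex x
    rw [Multiset.toFinset_card_of_nodup this]
    exact Nat.le_succ _

open NumberField

theorem splits_ringOfIntegers {K : Type*} [Field K] [NumberField K] (hm : 0 < m)
    (hK : ((eisensteinTrinomial m l s).map (algebraMap ℤ K)).Splits) :
    ((eisensteinTrinomial m l s).map (algebraMap ℤ (𝓞 K))).Splits := by
  refine Splits.of_splits_map_of_injective (i := algebraMap (𝓞 K) K)
    RingOfIntegers.coe_injective ?_ ?_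
  · rwa [Polynomial.map_map, ← IsScalarTower.algebraMap_eq]
  · intro a ha
    rw [Polynomial.map_map, ← IsScalarTower.algebraMap_eq] at ha
    have : aeval a (eisensteinTrinomial m l s) = 0 := by
      rw [← eval_map_algebraMap]; exact (mem_roots'.1 ha).2
    exact ⟨⟨a, eisensteinTrinomial m l s, monic hm, this⟩, rfl⟩

theorem ncard_rootSet_le {O : Type*} [CommRing O] [IsDomain O] (hm : 0 < m)
    (hO : ((eisensteinTrinomial m l s).map (algebraMap ℤ O)).Splits) (P : Ideal O) [P.IsPrime]
    (hP : ((m * (m + 1) * l * s : ℤ) : O) ∉ P) :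
    ((eisensteinTrinomial m l s).rootSet O).ncard ≤
      ((eisensteinTrinomial m l s).rootSet (O ⧸ P)).ncard + 1 := by
  classical
  set f := eisensteinTrinomial m l s with hf
  have h1 : (f.rootSet O).ncard ≤ m + 1 := by
    rw [rootSet_def, Set.ncard_coe_finset, aroots_def]
    refine (Multiset.toFinset_card_le _).trans ((card_roots' _).trans ?_)
    rw [(monic hm).natDegree_map, natDegree hm]
  have h2 : (f.map (algebraMap ℤ (O ⧸ P))).Splits := by
    have := hO.map (Ideal.Quotient.mk P)
    rwa [Polynomial.map_map, RingHom.ext_int ((Ideal.Quotient.mk P).comp (algebraMap ℤ O))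
      (algebraMap ℤ (O ⧸ P))] at this
  have h3 : Multiset.card (f.map (algebraMap ℤ (O ⧸ P))).roots = m + 1 := by
    rw [← h2.natDegree_eq_card_roots, (monic hm).natDegree_map, natDegree hm]
  have h4 := card_roots_map_le (algebraMap ℤ (O ⧸ P)) (m := m) (l := l) (s := s) (by
    rw [← map_intCast (Ideal.Quotient.mk P), Ne, Ideal.Quotient.eq_zero_iff_mem]
    exact hP)
  rw [← hf, h3] at h4
  rw [rootSet_def f (O ⧸ P), Set.ncard_coe_finset, aroots_def]
  exact h1.trans h4

end eisensteinTrinomial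

open NumberField in
theorem NumberField.exists_ne_one_mem_inertia {K : Type*} [Field K] [NumberField K] [IsGalois ℚ K]
    {q : ℤ} (hq : Prime q) (h : q ∣ NumberField.discr K) :
    ∃ (P : Ideal (𝓞 K)), P.IsPrime ∧ (q : 𝓞 K) ∈ P ∧ ∃ g ∈ P.inertia (K ≃ₐ[ℚ] K), g ≠ 1 := by
  have h1 := (NumberField.not_dvd_discr_iff_forall_mem K (𝓞 K) hq).not.1 (not_not.2 h)
  push Not at h1
  obtain ⟨P, hP, hqP, hram⟩ := h1
  refine ⟨P, hP, hqP, ?_⟩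
  by_contra! hcon
  apply hram
  have : PerfectField (P.under ℤ).ResidueField := inferInstance
  rw [← Ideal.ramificationIdx_eq_one_iff,
    ← Ideal.ramificationIdxIn_eq_ramificationIdx (P.under ℤ) P (K ≃ₐ[ℚ] K),
    ← Ideal.card_inertia_eq_ramificationIdxIn (G := K ≃ₐ[ℚ] K) (P.under ℤ) P]
  rw [(Subgroup.eq_bot_iff_forall _).2 hcon]
  simp

namespace eisensteinTrinomial

open NumberField

theorem nonempty_galois_mulEquiv_perm {m l : ℕ} {s : ℤ} {K : Type*} [Field K] [NumberField K]
    (hK : IsSplittingField ℚ K ((eisensteinTrinomial m l s).map (algebraMap ℤ ℚ)))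
    [Fact l.Prime] (hm : 0 < m) (hs : Squarefree s) (hs1 : ¬ IsUnit s)
    (hlm : IsCoprime (l : ℤ) m) (hsl : IsCoprime s ((m + 1) * l))
    (hM : Squarefree (trinomialDiscrFactor m l s)) (hM1 : ¬ IsUnit (trinomialDiscrFactor m l s))
    (hirr : Irreducible (X ^ m + C (s : ZMod l) : (ZMod l)[X])) :
    Nonempty ((K ≃ₐ[ℚ] K) ≃* Equiv.Perm (Fin (m + 1))) := by
  classical
  have hsl' := hsl.of_mul_right_right
  have hl0 : (l : ℤ) ≠ 0 := by exact_mod_cast (Fact.out : l.Prime).ne_zero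
  set f := eisensteinTrinomial m l s
  have hfm : f.Monic := monic hm
  have hirrQ : Irreducible (f.map (algebraMap ℤ ℚ)) := irreducible_map hm hs hsl' hs1
  have : IsGalois ℚ K := IsGalois.of_separable_splitting_field hirrQ.separable
  have hsplitK : (f.map (algebraMap ℤ K)).Splits := by
    have := hK.splits
    rwa [Polynomial.map_map, ← IsScalarTower.algebraMap_eq] at this
  have hsplit : (f.map (algebraMap ℤ (𝓞 K))).Splits := splits_ringOfIntegers hm hsplitK
  have himg : algebraMap (𝓞 K) K '' f.rootSet (𝓞 K) = f.rootSet K :=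
    hsplit.image_rootSet_of_map_ne_zero (IsScalarTower.toAlgHom ℤ (𝓞 K) K) (hfm.map _).ne_zero
  have hrootSet : (f.map (algebraMap ℤ ℚ)).rootSet K = f.rootSet K := by
    rw [rootSet_def, rootSet_def, aroots_def, aroots_def, Polynomial.map_map,
      ← IsScalarTower.algebraMap_eq]
  have hcard : Nat.card (f.rootSet (𝓞 K)) = m + 1 := by
    rw [Nat.card_coe_set_eq, ← Set.ncard_image_of_injective _ RingOfIntegers.coe_injective, himg,
      ← hrootSet, ← Nat.card_coe_set_eq, Nat.card_eq_fintype_card,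
      card_rootSet_eq_natDegree hirrQ.separable hK.splits, hfm.natDegree_map, natDegree hm]
  let Φ := MulAction.toPermHom (K ≃ₐ[ℚ] K) (f.rootSet (𝓞 K))
  have hinj : Function.Injective Φ := by
    rw [injective_iff_map_eq_one]
    intro σ hσ
    have : (σ : K →ₐ[ℚ] K) = AlgHom.id ℚ K := by
      refine AlgHom.ext_of_adjoin_eq_top hK.adjoin_rootSet ?_
      intro x hx
      rw [hrootSet, ← himg] at hx
      obtain ⟨y, hy, rfl⟩ := hx
      have h1 := congrArg (fun z : f.rootSet (𝓞 K) => ((z : 𝓞 K) : K))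
        (Equiv.ext_iff.1 hσ ⟨y, hy⟩)
      exact h1
    ext x
    exact DFunLike.congr_fun this x
  have h2 := isMultiplyPretransitive_rootSet (K := K) hm hs hs1 hsl hM hirr
  have hprim : MulAction.IsPreprimitive (K ≃ₐ[ℚ] K) (f.rootSet (𝓞 K)) :=
    MulAction.isPreprimitive_of_is_two_pretransitive h2
  have hprim' : MulAction.IsPreprimitive Φ.range (f.rootSet (𝓞 K)) :=
    let ψ : f.rootSet (𝓞 K) →ₑ[Φ.rangeRestrict] f.rootSet (𝓞 K) :=
      { toFun := id, map_smul' := fun _ _ => rfl }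
    MulAction.IsPreprimitive.of_surjective (f := ψ) Function.surjective_id
  -- a prime dividing the squarefree part of the discriminant yields a transposition
  obtain ⟨q, hq, hqM⟩ := WfDvdMonoid.exists_irreducible_factor hM1 hM.ne_zero
  have hqN : IsCoprime q (m * (m + 1) * l * s) := by
    refine IsCoprime.of_isCoprime_of_dvd_left ?_ hqM
    refine (isCoprime_trinomialDiscrFactor_mul hm hlm hsl).mul_right ?_
    exact isCoprime_trinomialDiscrFactor hsl
  have hqK : q ∣ NumberField.discr K := by
    have : Nonempty (f.rootSet (𝓞 K)) := (Nat.card_pos_iff.1 (hcard ▸ Nat.succ_pos m)).1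
    obtain ⟨x⟩ := this
    have hα : aeval ((x : 𝓞 K) : K) f = 0 := by
      rw [aeval_algebraMap_apply, aeval_eq_zero_of_mem_rootSet x.2, map_zero]
    obtain ⟨hfin, θ, -, hθ⟩ := exists_root_adjoin hm hs hsl' hs1 hα
    have hD := (discr_eq_and_adjoin_eq_top hm hl0 hs hs1 hsl hM hfin hθ).1
    refine dvd_trans ?_
      (NumberField.discr_dvd_discr (IntermediateField.adjoin ℚ {((x : 𝓞 K) : K)}) K)
    rw [hD]
    exact (hqM.mul_left _).mul_left _
  obtain ⟨P, hP, hqP, g, hg, hg1⟩ := NumberField.exists_ne_one_mem_inertia hq.prime hqK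
  have hNP : ((m * (m + 1) * l * s : ℤ) : 𝓞 K) ∉ P := by
    intro h
    obtain ⟨a, b, hab⟩ := hqN
    apply hP.ne_top
    rw [Ideal.eq_top_iff_one]
    have : (1 : 𝓞 K) = a * q + b * ((m * (m + 1) * l * s : ℤ) : 𝓞 K) := by
      have := congrArg (Int.cast : ℤ → 𝓞 K) hab
      push_cast at this ⊢
      exact this.symm
    rw [this]
    exact P.add_mem (P.mul_mem_left _ hqP) (P.mul_mem_left _ h)
  have hswap : (Φ g).IsSwap :=
    (hsplit.toPermHom_apply_eq_one_or_isSwap_of_ncard_le_of_mem_inertia P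
      (ncard_rootSet_le hm hsplit P hNP) g hg).resolve_left fun h =>
        hg1 (hinj (h.trans (map_one Φ).symm))
  have : Finite (f.rootSet (𝓞 K)) := Nat.finite_of_card_ne_zero (by omega)
  have htop := Equiv.Perm.subgroup_eq_top_of_isPreprimitive_of_isSwap_mem hprim' _ hswap ⟨g, rfl⟩
  have e := MulEquiv.ofBijective Φ ⟨hinj, MonoidHom.range_eq_top.1 htop⟩
  have e' : f.rootSet (𝓞 K) ≃ Fin (m + 1) := Finite.equivFinOfCardEq hcard
  exact ⟨e.trans e'.permCongrHom⟩

end eisensteinTrinomial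

end

theorem exists_numberField_isSplittingField (f : Polynomial ℚ) :
    ∃ (K : Type) (_ : Field K) (_ : NumberField K), Polynomial.IsSplittingField ℚ K f := by
  have key (K : Type) [Field K] [CharZero K] (A : Algebra ℚ K) [FiniteDimensional ℚ K]
      (h : Polynomial.IsSplittingField ℚ K f) :
      ∃ (K : Type) (_ : Field K) (_ : NumberField K), Polynomial.IsSplittingField ℚ K f := by
    obtain rfl := Subsingleton.elim A DivisionRing.toRatAlgebra
    exact ⟨K, inferInstance, { }, h⟩
  exact key f.SplittingField _ (Polynomial.IsSplittingField.splittingField f)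

theorem stmt_15 (habc : AbcConjecture) (n : ℕ) (hn : 2 ≤ n) :
    ∃ S₀ : Finset ℕ, (∀ q ∈ S₀, q.Prime) ∧
      ∀ p : ℕ, p.Prime → p ∉ S₀ → ∀ k : ℤ, ¬ ((p : ℤ) ∣ k) →
        ∃ f : Polynomial ℚ, Irreducible f ∧ f.natDegree = n ∧
          (∃ (K : Type) (_ : Field K) (_ : Algebra ℚ K),
            Polynomial.IsSplittingField ℚ K f ∧
            Nonempty ((K ≃ₐ[ℚ] K) ≃* Equiv.Perm (Fin n))) ∧
          (∃ (F : Type) (_ : Field F) (_ : NumberField F) (x : F),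
            Polynomial.aeval x f = 0 ∧ Module.finrank ℚ F = n ∧
            (NumberField.discr F : ℤ) ≡ k [ZMOD (p : ℤ)]) := by
  obtain ⟨m, rfl⟩ : ∃ m, n = m + 1 := ⟨n - 1, by omega⟩
  have hm : 0 < m := by omega
  refine ⟨(Finset.range (16 * (m * (m + 1)) ^ 4 + 1)).filter Nat.Prime,
    fun q hq => (Finset.mem_filter.1 hq).2, fun p hp hpS k hk => ?_⟩
  have hlt : 16 * (m * (m + 1)) ^ 4 < p := by
    by_contra! h
    exact hpS (Finset.mem_filter.2 ⟨Finset.mem_range.2 (Nat.lt_succ_of_le h), hp⟩)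
  have : Fact p.Prime := ⟨hp⟩
  obtain ⟨l, s, hl, hs1, hs, hlm, hsl, hM, hM1, hirr, hmod⟩ := exists_parameters hm hlt hk
  have : Fact l.Prime := ⟨hl⟩
  have hs1' : ¬ IsUnit s := by rw [Int.isUnit_iff]; omega
  have hsl' := hsl.of_mul_right_right
  have hl0 : (l : ℤ) ≠ 0 := by exact_mod_cast hl.ne_zero
  set g := (eisensteinTrinomial m l s).map (algebraMap ℤ ℚ) with hg
  have hgirr : Irreducible g := eisensteinTrinomial.irreducible_map hm hs hsl' hs1'
  obtain ⟨K, _, _, hK⟩ := exists_numberField_isSplittingField g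
  refine ⟨g, hgirr, ?_, ⟨K, inferInstance, inferInstance, hK, ?_⟩, ?_⟩
  · rw [hg, (eisensteinTrinomial.monic hm).natDegree_map, eisensteinTrinomial.natDegree hm]
  · exact eisensteinTrinomial.nonempty_galois_mulEquiv_perm hK hm hs hs1' hlm hsl hM hM1 hirr
  · obtain ⟨α, hα⟩ := hK.splits.exists_eval_eq_zero (by
      rw [Polynomial.degree_map]; exact hgirr.degree_pos.ne')
    rw [Polynomial.eval_map_algebraMap, hg, Polynomial.aeval_map_algebraMap] at hα
    obtain ⟨hfin, θ, -, hθ⟩ := eisensteinTrinomial.exists_root_adjoin hm hs hsl' hs1' hα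
    refine ⟨IntermediateField.adjoin ℚ {α}, inferInstance, inferInstance, θ, ?_, hfin, ?_⟩
    · rw [hg, Polynomial.aeval_map_algebraMap, Polynomial.aeval_algebraMap_apply, hθ, map_zero]
    · rw [(eisensteinTrinomial.discr_eq_and_adjoin_eq_top hm hl0 hs hs1' hsl hM hfin hθ).1]
      convert hmod using 1
end

section
/- Let p₁, …, p_r be distinct prime numbers and let K₁, …, K_r be subfields of a fixed algebraic closure of ℚ such that for each i, Kᵢ/ℚ is Galois with cyclic Galois group of order 3 and the set of prime numbers dividing the discriminant of the number field Kᵢ is exactly {pᵢ}. Then the compositum K₁·K₂⋯K_r has degree 3^r over ℚ; equivalently, its Galois group over ℚ is isomorphic to (ℤ/3ℤ)^r. -/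
open NumberField IntermediateField in
theorem NumberField.finrank_sup_and_natAbs_discr_sup {E : Type*} [Field E] [CharZero E]
    (A B : IntermediateField ℚ E) [NumberField A] [NumberField B]
    [NumberField (A ⊔ B : IntermediateField ℚ E)] [IsGalois ℚ A]
    (h : IsCoprime (discr A) (discr B)) :
    Module.finrank ℚ (A ⊔ B : IntermediateField ℚ E) =
        Module.finrank ℚ A * Module.finrank ℚ B ∧
      (discr (A ⊔ B : IntermediateField ℚ E)).natAbs =
        (discr A).natAbs ^ Module.finrank ℚ B * (discr B).natAbs ^ Module.finrank ℚ A := by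
  let A' := restrict (le_sup_left : A ≤ A ⊔ B)
  let B' := restrict (le_sup_right : B ≤ A ⊔ B)
  let eA : A ≃ₐ[ℚ] A' := restrictAlgEquiv (le_sup_left : A ≤ A ⊔ B)
  let eB : B ≃ₐ[ℚ] B' := restrictAlgEquiv (le_sup_right : B ≤ A ⊔ B)
  have : IsGalois ℚ A' := .of_algEquiv eA
  have hsup : A' ⊔ B' = ⊤ := by
    apply lift_injective
    rw [lift_sup, lift_top, lift_restrict, lift_restrict]
  have hcop : IsCoprime (discr A') (discr B') := by
    rwa [← discr_eq_discr_of_algEquiv _ eA, ← discr_eq_discr_of_algEquiv _ eB]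
  have hdis : A'.LinearDisjoint B' :=
    linearDisjoint_of_isGalois_isCoprime_discr _ A' B' hcop
  have hrank := hdis.finrank_sup
  have hdiscr : (discr (A ⊔ B : IntermediateField ℚ E)).natAbs =
      (discr A').natAbs ^ Module.finrank ℚ B' * (discr B').natAbs ^ Module.finrank ℚ A' :=
    natAbs_discr_eq_natAbs_discr_pow_mul_natAbs_discr_pow _ A' B' hdis hsup
    (isCoprime_differentIdeal_of_isCoprime_discr _ hcop)
  rw [hsup, finrank_top', ← eA.toLinearEquiv.finrank_eq, ← eB.toLinearEquiv.finrank_eq] at hrank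
  rw [← discr_eq_discr_of_algEquiv _ eA, ← discr_eq_discr_of_algEquiv _ eB,
    ← eA.toLinearEquiv.finrank_eq, ← eB.toLinearEquiv.finrank_eq] at hdiscr
  exact ⟨hrank, hdiscr⟩

open NumberField IntermediateField in
/-- The degree of the compositum of Galois number fields with pairwise coprime discriminants is
the product of their degrees, and an integer coprime to all the discriminants is coprime to the
discriminant of the compositum. -/
theorem NumberField.finrank_biSup_and_isCoprime_discr_biSup {E ι : Type*} [Field E] [CharZero E]
    (K : ι → IntermediateField ℚ E) [∀ i, NumberField (K i)] [∀ i, IsGalois ℚ (K i)]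
    (h : Pairwise fun i j ↦ IsCoprime (discr (K i)) (discr (K j))) (s : Finset ι) :
    ∀ [NumberField (⨆ i ∈ s, K i : IntermediateField ℚ E)],
      Module.finrank ℚ (⨆ i ∈ s, K i : IntermediateField ℚ E) =
          ∏ i ∈ s, Module.finrank ℚ (K i) ∧
        ∀ n : ℤ, (∀ i ∈ s, IsCoprime n (discr (K i))) →
          IsCoprime n (discr (⨆ i ∈ s, K i : IntermediateField ℚ E)) := by
  classical
  induction s using Finset.induction_on with
  | empty =>
    have hbot : (⨆ i ∈ (∅ : Finset ι), K i : IntermediateField ℚ E) = ⊥ := by simp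
    rw [hbot]
    intro _
    refine ⟨by simp, fun n _ ↦ ?_⟩
    rw [discr_eq_discr_of_algEquiv _ (botEquiv ℚ E), Rat.numberField_discr]
    exact isCoprime_one_right
  | insert j s hj ih =>
    rw [Finset.iSup_insert]
    intro _
    have : NumberField (⨆ i ∈ s, K i : IntermediateField ℚ E) :=
      { to_finiteDimensional := finiteDimensional_iSup_of_finset }
    obtain ⟨hrank, hcop⟩ := ih
    obtain ⟨hrank', hdiscr⟩ := finrank_sup_and_natAbs_discr_sup (K j) (⨆ i ∈ s, K i)
      (hcop _ fun i hi ↦ h fun hji ↦ hj (hji ▸ hi))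
    refine ⟨by rw [hrank', hrank, Finset.prod_insert hj], fun n hn ↦ ?_⟩
    have hn₁ := hn j (Finset.mem_insert_self j s)
    have hn₂ := hcop n fun i hi ↦ hn i (Finset.mem_insert_of_mem hi)
    rw [Int.isCoprime_iff_nat_coprime] at hn₁ hn₂ ⊢
    rw [hdiscr]
    exact (hn₁.pow_right _).mul_right (hn₂.pow_right _)

theorem stmt_17 (r : ℕ) (p : Fin r → ℕ) (hinj : Function.Injective p)
    (hprime : ∀ i, (p i).Prime)
    (K : Fin r → IntermediateField ℚ (AlgebraicClosure ℚ))
    [∀ i, FiniteDimensional ℚ (K i)]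
    [∀ i, IsGalois ℚ (K i)]
    (hcyc : ∀ i, IsCyclic (K i ≃ₐ[ℚ] K i))
    (hdeg : ∀ i, Module.finrank ℚ (K i) = 3)
    (hram : ∀ i, haveI : NumberField (K i) := ⟨⟩
      ∀ ℓ : ℕ, ℓ.Prime → ((ℓ : ℤ) ∣ NumberField.discr (K i) ↔ ℓ = p i)) :
    Module.finrank ℚ (⨆ i, K i : IntermediateField ℚ (AlgebraicClosure ℚ)) = 3 ^ r := by
  have (i : Fin r) : NumberField (K i) := ⟨⟩
  have hcop : Pairwise fun i j ↦
      IsCoprime (NumberField.discr (K i)) (NumberField.discr (K j)) := by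
    intro i j hij
    rw [Int.isCoprime_iff_nat_coprime]
    refine Nat.coprime_of_dvd fun ℓ hℓ hi hj ↦ hij (hinj ?_)
    rw [← (hram i ℓ hℓ).1 (Int.natCast_dvd.2 hi), ← (hram j ℓ hℓ).1 (Int.natCast_dvd.2 hj)]
  have : NumberField (⨆ i ∈ Finset.univ, K i :
      IntermediateField ℚ (AlgebraicClosure ℚ)) :=
    { to_finiteDimensional := IntermediateField.finiteDimensional_iSup_of_finset }
  have hrank := (NumberField.finrank_biSup_and_isCoprime_discr_biSup K hcop Finset.univ).1
  have huniv : ⨆ i ∈ Finset.univ, K i = ⨆ i, K i := by simp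
  rw [huniv] at hrank
  simpa [hdeg] using hrank
end
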